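/- If v ∈ H²(ℝ) satisfies −v''(x) + (2 − 24·H_{0,1}(x)² + 30·H_{0,1}(x)⁴)·v(x) = 0 for almost every x ∈ ℝ, then there exists c ∈ ℝ such that v = c·H_{0,1}' (i.e., the kernel of the linearized operator −∂²_x + Ü(H_{0,1}) acting on H²(ℝ) is spanned by the translation mode H_{0,1}'). -/

import Mathlib

noncomputable section

open MeasureTheory Real

/-- The φ⁶ kink `H_{0,1}(x) = e^{√2 x} / (1 + e^{2√2 x})^{1/2}`. -/
def H01 (x : ℝ) : ℝ := Real.exp (Real.sqrt 2 * x) / Real.sqrt (1 + Real.exp (2 * Real.sqrt 2 * x))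

/-- The reflected kink `H_{-1,0}(x) = -H_{0,1}(-x)`. -/
def Hm10 (x : ℝ) : ℝ := - H01 (-x)

/-- The φ⁶ potential `U(φ) = φ²(1-φ²)²`. -/
def U (p : ℝ) : ℝ := p ^ 2 * (1 - p ^ 2) ^ 2

/-- `U̇(φ) = 2φ - 8φ³ + 6φ⁵`. -/
def Udot (p : ℝ) : ℝ := 2 * p - 8 * p ^ 3 + 6 * p ^ 5

/-- `Ü(φ) = 2 - 24φ² + 30φ⁴`. -/
def Uddot (p : ℝ) : ℝ := 2 - 24 * p ^ 2 + 30 * p ^ 4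

/-- `U⁽³⁾(φ) = -48φ + 120φ³`. -/
def U3 (p : ℝ) : ℝ := -48 * p + 120 * p ^ 3

/-- The `L²` norm of a real function, as `√(∫ f²)`. -/
def L2norm (f : ℝ → ℝ) : ℝ := Real.sqrt (∫ x : ℝ, f x ^ 2)

/-- The `H¹` norm of a real function, as `√(∫ f² + f'²)`. -/
def H1norm (f : ℝ → ℝ) : ℝ := Real.sqrt (∫ x : ℝ, (f x ^ 2 + deriv f x ^ 2))

/-- Square integrability. -/
def InL2 (f : ℝ → ℝ) : Prop := Integrable (fun x : ℝ => f x ^ 2)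

/-- Membership in `H¹(ℝ)`. -/
def InH1 (f : ℝ → ℝ) : Prop := InL2 f ∧ InL2 (deriv f)

/-- The potential energy `E_pot(φ) = ∫ (1/2) φ'² + U(φ)`. -/
def Epot (f : ℝ → ℝ) : ℝ := ∫ x : ℝ, ((1 / 2) * deriv f x ^ 2 + U (f x))

theorem H01_pos (x : ℝ) : 0 < H01 x := by
  unfold H01
  positivity

theorem H01_lt_one (x : ℝ) : H01 x < 1 := by
  unfold H01
  rw [div_lt_one (by positivity)]
  apply Real.lt_sqrt_of_sq_lt
  have h : Real.exp (Real.sqrt 2 * x) ^ 2 = Real.exp (2 * Real.sqrt 2 * x) := by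
    rw [sq, ← Real.exp_add]
    ring_nf
  linarith

/-- The Bogomolny equation `H' = √2 (H - H³)` of the kink. -/
theorem hasDerivAt_H01 (x : ℝ) :
    HasDerivAt H01 (Real.sqrt 2 * (H01 x - H01 x ^ 3)) x := by
  have hE : Real.exp (2 * Real.sqrt 2 * x) = Real.exp (Real.sqrt 2 * x) ^ 2 := by
    rw [sq, ← Real.exp_add]
    ring_nf
  have hpos : 0 < 1 + Real.exp (2 * Real.sqrt 2 * x) := by positivity
  have h1 : HasDerivAt (fun y : ℝ => Real.exp (Real.sqrt 2 * y))
      (Real.exp (Real.sqrt 2 * x) * (Real.sqrt 2 * 1)) x :=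
    ((hasDerivAt_id x).const_mul (Real.sqrt 2)).exp
  have h2 : HasDerivAt (fun y : ℝ => 1 + Real.exp (2 * Real.sqrt 2 * y))
      (Real.exp (2 * Real.sqrt 2 * x) * (2 * Real.sqrt 2 * 1)) x :=
    (((hasDerivAt_id x).const_mul (2 * Real.sqrt 2)).exp).const_add 1
  have hr : 0 < Real.sqrt (1 + Real.exp (2 * Real.sqrt 2 * x)) := Real.sqrt_pos.2 hpos
  refine (h1.div (h2.sqrt hpos.ne') hr.ne').congr_deriv ?_
  unfold H01
  rw [hE]
  field_simp

theorem deriv_H01 : deriv H01 = fun x => Real.sqrt 2 * (H01 x - H01 x ^ 3) :=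
  funext fun x => (hasDerivAt_H01 x).deriv

theorem hasDerivAt_deriv_H01 (x : ℝ) :
    HasDerivAt (deriv H01) (2 * H01 x - 8 * H01 x ^ 3 + 6 * H01 x ^ 5) x := by
  rw [deriv_H01]
  have h := hasDerivAt_H01 x
  refine ((h.sub (h.pow 3)).const_mul (Real.sqrt 2)).congr_deriv ?_
  have h2 : Real.sqrt 2 ^ 2 = 2 := Real.sq_sqrt (by norm_num)
  push_cast
  linear_combination (H01 x - H01 x ^ 3) * (1 - 3 * H01 x ^ 2) * h2

theorem hasDerivAt_deriv_deriv_H01 (x : ℝ) :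
    HasDerivAt (fun y => 2 * H01 y - 8 * H01 y ^ 3 + 6 * H01 y ^ 5)
      ((2 - 24 * H01 x ^ 2 + 30 * H01 x ^ 4) * deriv H01 x) x := by
  have h := hasDerivAt_H01 x
  refine (((h.const_mul 2).sub ((h.pow 3).const_mul 8)).add
    ((h.pow 5).const_mul 6)).congr_deriv ?_
  rw [h.deriv]
  push_cast
  ring

theorem deriv_H01_pos (x : ℝ) : 0 < deriv H01 x := by
  rw [(hasDerivAt_H01 x).deriv]
  have h0 := H01_pos x
  have h1 := H01_lt_one x
  have : 0 < H01 x - H01 x ^ 3 := by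
    have : H01 x ^ 3 < H01 x ^ 1 := pow_lt_pow_right_of_lt_one₀ h0 h1 (by norm_num)
    linarith
  positivity

theorem sq_deriv_H01_le (x : ℝ) : deriv H01 x ^ 2 ≤ 2 := by
  rw [(hasDerivAt_H01 x).deriv, mul_pow, Real.sq_sqrt (by norm_num)]
  have h0 := H01_pos x
  have h1 := H01_lt_one x
  have h3 : H01 x ^ 3 ≤ H01 x := pow_le_of_le_one h0.le h1.le (by norm_num)
  have h4 : 0 < H01 x ^ 3 := by positivity
  have : (H01 x - H01 x ^ 3) ^ 2 ≤ 1 := pow_le_one₀ (by linarith) (by linarith)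
  linarith

theorem sq_deriv_deriv_H01_le (x : ℝ) :
    (2 * H01 x - 8 * H01 x ^ 3 + 6 * H01 x ^ 5) ^ 2 ≤ 64 := by
  have h0 := H01_pos x
  have h1 := H01_lt_one x
  have h3 : H01 x ^ 3 ≤ 1 := pow_le_one₀ h0.le h1.le
  have h5 : H01 x ^ 5 ≤ 1 := pow_le_one₀ h0.le h1.le
  have h3' : 0 < H01 x ^ 3 := by positivity
  have h5' : 0 < H01 x ^ 5 := by positivity
  rw [show (64 : ℝ) = 8 ^ 2 by norm_num]
  exact sq_le_sq' (by linarith) (by linarith)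

/-- An everywhere differentiable function whose derivative vanishes almost everywhere is
constant. -/
theorem eq_of_hasDerivAt_of_ae_eq_zero {f f' : ℝ → ℝ} (hf : ∀ x, HasDerivAt f (f' x) x)
    (h0 : ∀ᵐ x : ℝ, f' x = 0) (a b : ℝ) : f a = f b := by
  have hint : IntervalIntegrable f' volume b a :=
    (intervalIntegrable_const (c := (0 : ℝ))).congr_ae
      (ae_restrict_of_ae (h0.mono fun _ hx => hx.symm))
  have h := intervalIntegral.integral_eq_sub_of_hasDerivAt (fun x _ => hf x) hint
  rw [intervalIntegral.integral_congr_ae (g := fun _ => 0) (h0.mono fun _ hx _ => hx),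
    intervalIntegral.integral_zero] at h
  linarith

/-- The kernel of the linearized operator `-∂²_x + Ü(H_{0,1})` on `H²(ℝ)` is spanned by
the translation mode `H_{0,1}'`. -/
theorem kernel_linearized_operator :
    ∀ v : ℝ → ℝ,
      (∀ x, DifferentiableAt ℝ v x) → (∀ x, DifferentiableAt ℝ (deriv v) x) →
      InL2 v → InL2 (deriv v) → InL2 (deriv (deriv v)) →
      (∀ᵐ x : ℝ ∂volume,
        -deriv (deriv v) x + (2 - 24 * H01 x ^ 2 + 30 * H01 x ^ 4) * v x = 0) →
      ∃ c : ℝ, v = fun x => c * deriv H01 x := by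
  intro v hv hv' hL hL' _ hode
  set D : ℝ → ℝ := fun x => 2 * H01 x - 8 * H01 x ^ 3 + 6 * H01 x ^ 5 with hD
  set W : ℝ → ℝ := fun x => deriv v x * deriv H01 x - v x * D x with hW
  have hWd : ∀ x, HasDerivAt W
      ((deriv (deriv v) x - (2 - 24 * H01 x ^ 2 + 30 * H01 x ^ 4) * v x) * deriv H01 x) x := by
    intro x
    refine (((hv' x).hasDerivAt.mul (hasDerivAt_deriv_H01 x)).sub
      ((hv x).hasDerivAt.mul (hasDerivAt_deriv_deriv_H01 x))).congr_deriv ?_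
    ring
  have hWc : ∀ x, W x = W 0 := fun x => by
    refine eq_of_hasDerivAt_of_ae_eq_zero hWd ?_ x 0
    filter_upwards [hode] with y hy
    linear_combination -deriv H01 y * hy
  have hW0 : W 0 = 0 := by
    have hint : Integrable (fun _ : ℝ => W 0 ^ 2) := by
      refine ((hL'.const_mul 4).add (hL.const_mul 128)).mono' aestronglyMeasurable_const
        (Filter.Eventually.of_forall fun x => ?_)
      rw [Real.norm_of_nonneg (sq_nonneg _), ← hWc x]
      have h1 := mul_le_mul_of_nonneg_left (sq_deriv_H01_le x) (sq_nonneg (deriv v x))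
      have h2 := mul_le_mul_of_nonneg_left (sq_deriv_deriv_H01_le x) (sq_nonneg (v x))
      simp only [hW, hD, Pi.add_apply]
      nlinarith [sq_nonneg (deriv v x * deriv H01 x
        + v x * (2 * H01 x - 8 * H01 x ^ 3 + 6 * H01 x ^ 5))]
    rw [integrable_const_iff] at hint
    rcases hint with h | h
    · exact pow_eq_zero_iff (two_ne_zero) |>.1 h
    · exact absurd h.measure_univ_lt_top (by simp)
  have hq : ∀ x, HasDerivAt (fun y => v y / deriv H01 y) 0 x := fun x => by
    refine ((hv x).hasDerivAt.div (hasDerivAt_deriv_H01 x) (deriv_H01_pos x).ne').congr_deriv ?_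
    have h : deriv v x * deriv H01 x - v x * D x = 0 := (hWc x).trans hW0
    rw [h, zero_div]
  refine ⟨v 0 / deriv H01 0, funext fun x => ?_⟩
  have h := eq_of_hasDerivAt_of_ae_eq_zero hq (Filter.Eventually.of_forall fun _ => rfl) x 0
  exact (div_eq_iff (deriv_H01_pos x).ne').1 h
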